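/- Suppose condition (⋆⋆) holds. Then every simple graph g on {1,…,n} whose degree sequence satisfies η_i(g) = k_i for every firm i is pairwise stable for the total profits Y: (1) for every edge ij of g, Y_i(g) ≥ Y_i(g − ij) and Y_j(g) ≥ Y_j(g − ij); (2) for every pair of distinct vertices ij not an edge of g, if Y_i(g + ij) > Y_i(g) then Y_j(g + ij) < Y_j(g). -/

import Mathlib

open Finset

noncomputable def degree' {n : ℕ} (g : SimpleGraph (Fin n)) (i : Fin n) : ℕ :=
  Nat.card {j | g.Adj i j}

/-- The graph `g` with the edge `ij` deleted. -/
def delE {n : ℕ} (g : SimpleGraph (Fin n)) (i j : Fin n) : SimpleGraph (Fin n) :=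
  g.deleteEdges {s(i, j)}

/-- The graph `g` with the edge `ij` added. -/
def addE {n : ℕ} (g : SimpleGraph (Fin n)) (i j : Fin n) : SimpleGraph (Fin n) :=
  g ⊔ SimpleGraph.fromEdgeSet {s(i, j)}

/-- Marginal production cost of firm `i` under collaboration graph `g`. -/
noncomputable def cost {n : ℕ} (γ₀ : ℝ) (f : ℝ → ℝ) (k : Fin n → ℕ)
    (g : SimpleGraph (Fin n)) (i : Fin n) : ℝ :=
  γ₀ + f ((degree' g i : ℝ) - (k i : ℝ))

/-- Cournot equilibrium quantity shipped by firm `i` to market node `l`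
under collaboration graph `g`. -/
noncomputable def dq {n : ℕ} {V : Type*} [Fintype V] (αl : V → ℝ) (γ₀ : ℝ)
    (s : V → Fin n → ℝ) (f : ℝ → ℝ) (k : Fin n → ℕ)
    (g : SimpleGraph (Fin n)) (l : V) (i : Fin n) : ℝ :=
  (αl l - γ₀ - n * (s l i + f ((degree' g i : ℝ) - (k i : ℝ)))
    + ∑ j ∈ univ.erase i, (s l j + f ((degree' g j : ℝ) - (k j : ℝ)))) / (n + 1)

/-- Price at market node `l` under collaboration graph `g`. -/
noncomputable def priceAt {n : ℕ} {V : Type*} [Fintype V] (αl : V → ℝ) (γ₀ : ℝ)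
    (s : V → Fin n → ℝ) (f : ℝ → ℝ) (k : Fin n → ℕ)
    (g : SimpleGraph (Fin n)) (l : V) : ℝ :=
  αl l - ∑ i, dq αl γ₀ s f k g l i

/-- Profit of firm `i` at market node `l` under collaboration graph `g`. -/
noncomputable def profitAt {n : ℕ} {V : Type*} [Fintype V] (αl : V → ℝ) (γ₀ : ℝ)
    (s : V → Fin n → ℝ) (f : ℝ → ℝ) (k : Fin n → ℕ)
    (g : SimpleGraph (Fin n)) (l : V) (i : Fin n) : ℝ :=
  dq αl γ₀ s f k g l i * (priceAt αl γ₀ s f k g l - cost γ₀ f k g i - s l i)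

/-- Total profit of firm `i` across all spatial markets under collaboration graph `g`. -/
noncomputable def totProfit {n : ℕ} {V : Type*} [Fintype V] (αl : V → ℝ) (γ₀ : ℝ)
    (s : V → Fin n → ℝ) (f : ℝ → ℝ) (k : Fin n → ℕ)
    (g : SimpleGraph (Fin n)) (i : Fin n) : ℝ :=
  ∑ l, profitAt αl γ₀ s f k g l i

lemma degree'_addE_left {n : ℕ} (g : SimpleGraph (Fin n)) {i j : Fin n} (hij : i ≠ j)
    (h : ¬ g.Adj i j) : degree' (addE g i j) i = degree' g i + 1 := by
  have hset : {m | (addE g i j).Adj i m} = insert j {m | g.Adj i m} := by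
    ext m
    simp only [addE, Set.mem_ofPred_eq, SimpleGraph.sup_adj, SimpleGraph.fromEdgeSet_adj,
      Set.mem_singleton_iff, Sym2.eq_iff, Set.mem_insert_iff]
    grind
  have hcard := Set.ncard_insert_of_notMem (s := {m | g.Adj i m}) (a := j) h
  rw [← hset] at hcard
  exact hcard

lemma addE_comm {n : ℕ} (g : SimpleGraph (Fin n)) (i j : Fin n) : addE g i j = addE g j i := by
  simp only [addE, Sym2.eq_swap]

lemma delE_comm {n : ℕ} (g : SimpleGraph (Fin n)) (i j : Fin n) : delE g i j = delE g j i := by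
  simp only [delE, Sym2.eq_swap]

lemma degree'_addE_of_ne {n : ℕ} (g : SimpleGraph (Fin n)) {i j m : Fin n} (hi : m ≠ i)
    (hj : m ≠ j) : degree' (addE g i j) m = degree' g m := by
  have hset : {x | (addE g i j).Adj m x} = {x | g.Adj m x} := by
    ext x
    simp only [addE, Set.mem_ofPred_eq, SimpleGraph.sup_adj, SimpleGraph.fromEdgeSet_adj,
      Set.mem_singleton_iff, Sym2.eq_iff]
    grind
  rw [degree', degree', hset]

lemma not_adj_delE {n : ℕ} (g : SimpleGraph (Fin n)) (i j : Fin n) : ¬ (delE g i j).Adj i j := by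
  simp [delE]

lemma addE_delE {n : ℕ} {g : SimpleGraph (Fin n)} {i j : Fin n} (h : g.Adj i j) :
    addE (delE g i j) i j = g := by
  ext x y
  simp only [addE, delE, SimpleGraph.sup_adj, SimpleGraph.deleteEdges_adj,
    SimpleGraph.fromEdgeSet_adj, Set.mem_singleton_iff, Sym2.eq_iff]
  have := h.symm
  have := h.ne
  grind

lemma degree'_delE_left {n : ℕ} {g : SimpleGraph (Fin n)} {i j : Fin n} (h : g.Adj i j) :
    degree' (delE g i j) i + 1 = degree' g i := by
  rw [← degree'_addE_left _ h.ne (not_adj_delE g i j), addE_delE h]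

lemma degree'_delE_of_ne {n : ℕ} {g : SimpleGraph (Fin n)} {i j m : Fin n} (h : g.Adj i j)
    (hi : m ≠ i) (hj : m ≠ j) : degree' (delE g i j) m = degree' g m := by
  rw [← degree'_addE_of_ne _ hi hj, addE_delE h]

/-- At the Cournot equilibrium the markup equals the shipped quantity. -/
lemma profitAt_eq_sq {n : ℕ} {V : Type*} [Fintype V] (αl : V → ℝ) (γ₀ : ℝ)
    (s : V → Fin n → ℝ) (f : ℝ → ℝ) (k : Fin n → ℕ) (g : SimpleGraph (Fin n)) (l : V)
    (i : Fin n) : profitAt αl γ₀ s f k g l i = dq αl γ₀ s f k g l i ^ 2 := by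
  have hn : (n : ℝ) + 1 ≠ 0 := by positivity
  set x : Fin n → ℝ := fun m => s l m + f ((degree' g m : ℝ) - (k m : ℝ))
  have hd : ∀ m, dq αl γ₀ s f k g l m = (αl l - γ₀ + ∑ j, x j) / (n + 1) - x m := by
    intro m
    have hsum : ∑ j ∈ univ.erase m, x j = ∑ j, x j - x m := by
      rw [← Finset.add_sum_erase univ x (Finset.mem_univ m)]
      ring
    simp only [dq]
    change (αl l - γ₀ - n * x m + ∑ j ∈ univ.erase m, x j) / (n + 1) = _
    rw [hsum]
    field_simp
    ring
  have hprice : priceAt αl γ₀ s f k g l - cost γ₀ f k g i - s l i = dq αl γ₀ s f k g l i := by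
    have hxi : x i = s l i + f ((degree' g i : ℝ) - (k i : ℝ)) := rfl
    simp only [priceAt, cost, hd, Finset.sum_sub_distrib, Finset.sum_const, Finset.card_univ,
      Fintype.card_fin, nsmul_eq_mul]
    rw [hxi]
    field_simp
    ring
  rw [profitAt, hprice, sq]

/-- If every firm meets its target degree under `g`, then moving two firms `i` and `j` off target
by the same amount `e` does not raise the total profit of `i`, as long as `i` ships enough
under `g`. -/
lemma totProfit_le_of_common_shift {n : ℕ} (hn : 2 ≤ n) {V : Type*} [Fintype V] (αl : V → ℝ)
    (γ₀ : ℝ) (s : V → Fin n → ℝ) (f : ℝ → ℝ) (k : Fin n → ℕ) {g g' : SimpleGraph (Fin n)}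
    (hdeg : ∀ m, degree' g m = k m) {i j : Fin n} (hij : i ≠ j) {e : ℝ} (he : f 0 ≤ f e)
    (hi : (degree' g' i : ℝ) - k i = e) (hj : (degree' g' j : ℝ) - k j = e)
    (hm : ∀ m, m ≠ i → m ≠ j → degree' g' m = k m)
    (hlarge : ∀ l, ((n : ℝ) - 1) / 2 * (f e - f 0) ≤ (n + 1) * dq αl γ₀ s f k g l i) :
    totProfit αl γ₀ s f k g' i ≤ totProfit αl γ₀ s f k g i := by
  refine Finset.sum_le_sum fun l _ => ?_
  rw [profitAt_eq_sq, profitAt_eq_sq]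
  have hn' : (2 : ℝ) ≤ n := by exact_mod_cast hn
  have hshift : (n + 1) * dq αl γ₀ s f k g' l i =
      (n + 1) * dq αl γ₀ s f k g l i - (n - 1) * (f e - f 0) := by
    have hjmem : j ∈ univ.erase i := by simp [hij.symm]
    have hrest : ∑ m ∈ (univ.erase i).erase j, (s l m + f ((degree' g' m : ℝ) - (k m : ℝ))) =
        ∑ m ∈ (univ.erase i).erase j, (s l m + f ((degree' g m : ℝ) - (k m : ℝ))) := by
      refine Finset.sum_congr rfl fun m hmem => ?_
      simp only [Finset.mem_erase] at hmem
      rw [hm m hmem.2.1 hmem.1, hdeg]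
    have hcancel : (n : ℝ) + 1 ≠ 0 := by positivity
    rw [dq, dq, mul_div_cancel₀ _ hcancel, mul_div_cancel₀ _ hcancel,
      ← Finset.add_sum_erase _ _ hjmem, ← Finset.add_sum_erase _ _ hjmem, hrest, hi, hj, hdeg i,
      hdeg j, sub_self, sub_self]
    ring
  have hpos : (0 : ℝ) < n + 1 := by positivity
  have hdrop : 0 ≤ ((n : ℝ) - 1) * (f e - f 0) := mul_nonneg (by linarith) (by linarith)
  have hl := hlarge l
  refine sq_le_sq' (le_of_mul_le_mul_left ?_ hpos) (le_of_mul_le_mul_left ?_ hpos) <;> linarith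

/-- Lower bound for the quantity shipped by a firm when every firm meets its target degree. -/
lemma le_dq_of_degree'_eq {n : ℕ} {V : Type*} [Fintype V] (αl : V → ℝ) (γ₀ : ℝ)
    (s : V → Fin n → ℝ) (hs : ∀ l i, 0 ≤ s l i) (f : ℝ → ℝ) (hf0 : ∀ x, 0 ≤ f x)
    (k : Fin n → ℕ) {g : SimpleGraph (Fin n)} (hdeg : ∀ m, degree' g m = k m) (l : V)
    (i : Fin n) :
    αl l - γ₀ - n * (s l i + f 0) ≤ (n + 1) * dq αl γ₀ s f k g l i := by
  have hsum : 0 ≤ ∑ j ∈ univ.erase i, (s l j + f ((degree' g j : ℝ) - (k j : ℝ))) :=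
    Finset.sum_nonneg fun j _ => add_nonneg (hs l j) (hf0 _)
  have hcancel : (n : ℝ) + 1 ≠ 0 := by positivity
  rw [dq, mul_div_cancel₀ _ hcancel, hdeg i, sub_self]
  linarith

/-- under condition (⋆⋆), every graph with degree sequence `k` is
pairwise stable for the total profits. -/
theorem stmt18 (n : ℕ) (hn : 2 ≤ n) (V : Type*) [Fintype V] (αl : V → ℝ) (γ₀ : ℝ)
    (s : V → Fin n → ℝ) (hs : ∀ l i, 0 ≤ s l i) (f : ℝ → ℝ)
    (hconv : ConvexOn ℝ Set.univ f) (hf0 : ∀ x, 0 ≤ f x) (hfmin : ∀ x, f 0 ≤ f x)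
    (k : Fin n → ℕ) (hk : ∀ i, k i ≤ n - 1)
    (M : ℝ) (hM : IsGreatest (Set.range fun p : V × Fin n => s p.1 p.2) M)
    (hstar : ∀ l : V, 0 < αl l - γ₀ - n * (M + max (f ((n : ℝ) - 1)) (f (1 - (n : ℝ))))
      - (((n : ℝ) - 1) / 2) * max (f 1 - f 0) (f (-1) - f 0))
    (g : SimpleGraph (Fin n)) (hdeg : ∀ i, degree' g i = k i) :
    (∀ i j : Fin n, g.Adj i j →
      totProfit αl γ₀ s f k (delE g i j) i ≤ totProfit αl γ₀ s f k g i ∧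
      totProfit αl γ₀ s f k (delE g i j) j ≤ totProfit αl γ₀ s f k g j) ∧
    (∀ i j : Fin n, i ≠ j → ¬ g.Adj i j →
      totProfit αl γ₀ s f k g i < totProfit αl γ₀ s f k (addE g i j) i →
      totProfit αl γ₀ s f k (addE g i j) j < totProfit αl γ₀ s f k g j) := by
  have hlarge : ∀ e : ℝ, f e - f 0 ≤ max (f 1 - f 0) (f (-1) - f 0) → ∀ i l,
      ((n : ℝ) - 1) / 2 * (f e - f 0) ≤ (n + 1) * dq αl γ₀ s f k g l i := by
    intro e he i l
    have hn' : (2 : ℝ) ≤ n := by exact_mod_cast hn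
    have hsM : s l i ≤ M := hM.2 ⟨(l, i), rfl⟩
    have hcost : (n : ℝ) * (s l i + f 0) ≤
        n * (M + max (f ((n : ℝ) - 1)) (f (1 - (n : ℝ)))) :=
      mul_le_mul_of_nonneg_left (add_le_add hsM ((hfmin _).trans (le_max_left _ _)))
        (by linarith)
    have hgap := mul_le_mul_of_nonneg_left he (show 0 ≤ ((n : ℝ) - 1) / 2 by linarith)
    linarith [hstar l, le_dq_of_degree'_eq αl γ₀ s hs f hf0 k hdeg l i]
  have hdel : ∀ i j, g.Adj i j →
      totProfit αl γ₀ s f k (delE g i j) i ≤ totProfit αl γ₀ s f k g i := by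
    intro i j h
    refine totProfit_le_of_common_shift hn αl γ₀ s f k hdeg h.ne (hfmin (-1)) ?_ ?_
      (fun m hi hj => (degree'_delE_of_ne h hi hj).trans (hdeg m))
      (hlarge (-1) (le_max_right _ _) i)
    · rw [← hdeg i, ← degree'_delE_left h]
      push_cast
      ring
    · rw [← hdeg j, ← degree'_delE_left h.symm, delE_comm g i j]
      push_cast
      ring
  have hadd : ∀ i j, i ≠ j → ¬ g.Adj i j →
      totProfit αl γ₀ s f k (addE g i j) i ≤ totProfit αl γ₀ s f k g i := by
    intro i j hij h
    refine totProfit_le_of_common_shift hn αl γ₀ s f k hdeg hij (hfmin 1) ?_ ?_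
      (fun m hi hj => (degree'_addE_of_ne g hi hj).trans (hdeg m))
      (hlarge 1 (le_max_left _ _) i)
    · rw [degree'_addE_left g hij h, hdeg i]
      push_cast
      ring
    · rw [addE_comm, degree'_addE_left g hij.symm (fun h' => h h'.symm), hdeg j]
      push_cast
      ring
  exact ⟨fun i j h => ⟨hdel i j h, delE_comm g i j ▸ hdel j i h.symm⟩,
    fun i j hij h hlt => absurd hlt (hadd i j hij h).not_gt⟩
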